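/- arXiv:2006.00282 — 2 statements merged into one kernel-verified Lean document; each statement's English description precedes it below -/
import Mathlib

section
/- For ρ ∈ [0,1) and Φ > 1 − ρ, the gap h(z) := v̲(z) − U(e^z) is nonnegative on ℝ and vanishes exactly on [b̲, ∞); it is strictly decreasing on (−∞, b̲], with derivative h′(z) = e^{(1−ρ)z}( e^{(Φ−1+ρ)(z−b̲)} − 1 ) for z < b̲, and h(z) → 1/(1−ρ) as z → −∞. -/
/-- CRRA utility evaluated at `e^x`: `U(e^x) = (e^{(1−ρ)x} − 1)/(1−ρ)`. -/
noncomputable def Ue (ρ x : ℝ) : ℝ := (Real.exp ((1 - ρ) * x) - 1) / (1 - ρ)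

/-- The take-profit threshold `b̲ = (1/(1−ρ)) log(Φ/(Φ−1+ρ))`. -/
noncomputable def bLow (ρ Φ : ℝ) : ℝ := (1 / (1 - ρ)) * Real.log (Φ / (Φ - 1 + ρ))

/-- The value function `v̲(x) = e^{Φ(x−b̲)} U(e^{b̲})` for `x ≤ b̲`, and `U(e^x)` for `x > b̲`. -/
noncomputable def vLow (ρ Φ x : ℝ) : ℝ :=
  if x ≤ bLow ρ Φ then Real.exp (Φ * (x - bLow ρ Φ)) * Ue ρ (bLow ρ Φ) else Ue ρ x

theorem exp_mul_bLow {ρ Φ : ℝ} (hρ : ρ ∈ Set.Ico (0 : ℝ) 1) (hΦ : 1 - ρ < Φ) :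
    Real.exp ((1 - ρ) * bLow ρ Φ) = Φ / (Φ - 1 + ρ) := by
  have h1 : 0 < 1 - ρ := sub_pos.2 hρ.2
  have h2 : 0 < Φ - 1 + ρ := by linarith
  have h3 : 0 < Φ := h1.trans hΦ
  rw [bLow, ← mul_assoc, mul_one_div_cancel h1.ne', one_mul, Real.exp_log (div_pos h3 h2)]

/-- Smooth fit at the threshold: `Φ U(e^{b̲}) = e^{(1−ρ)b̲}`. -/
theorem mul_Ue_bLow {ρ Φ : ℝ} (hρ : ρ ∈ Set.Ico (0 : ℝ) 1) (hΦ : 1 - ρ < Φ) :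
    Φ * Ue ρ (bLow ρ Φ) = Real.exp ((1 - ρ) * bLow ρ Φ) := by
  have h1 : 1 - ρ ≠ 0 := (sub_pos.2 hρ.2).ne'
  have h2 : Φ - 1 + ρ ≠ 0 := by linarith
  rw [Ue, exp_mul_bLow hρ hΦ]
  field_simp
  ring

theorem hasDerivAt_Ue {ρ : ℝ} (hρ : ρ ≠ 1) (z : ℝ) :
    HasDerivAt (Ue ρ) (Real.exp ((1 - ρ) * z)) z := by
  have h1 : 1 - ρ ≠ 0 := sub_ne_zero.2 hρ.symm
  have h := ((((hasDerivAt_id z).const_mul (1 - ρ)).exp).sub_const 1).div_const (1 - ρ)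
  refine h.congr_deriv ?_
  simp only [id_eq]
  field_simp

theorem hasDerivAt_gap_of_le {ρ Φ : ℝ} (hρ : ρ ∈ Set.Ico (0 : ℝ) 1) (hΦ : 1 - ρ < Φ) (z : ℝ) :
    HasDerivAt (fun z => Real.exp (Φ * (z - bLow ρ Φ)) * Ue ρ (bLow ρ Φ) - Ue ρ z)
      (Real.exp ((1 - ρ) * z) * (Real.exp ((Φ - 1 + ρ) * (z - bLow ρ Φ)) - 1)) z := by
  have h := (((((hasDerivAt_id z).sub_const (bLow ρ Φ)).const_mul Φ).exp).mul_const
    (Ue ρ (bLow ρ Φ))).sub (hasDerivAt_Ue hρ.2.ne z)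
  refine h.congr_deriv ?_
  simp only [id_eq, mul_one]
  rw [mul_assoc, mul_Ue_bLow hρ hΦ, mul_sub_one, ← Real.exp_add, ← Real.exp_add]
  ring_nf

theorem tendsto_Ue_atBot {ρ : ℝ} (hρ : ρ < 1) :
    Filter.Tendsto (Ue ρ) Filter.atBot (nhds (-(1 / (1 - ρ)))) := by
  have h := ((Real.tendsto_exp_atBot.comp
    (Filter.tendsto_id.const_mul_atBot (sub_pos.2 hρ))).sub_const 1).div_const (1 - ρ)
  rw [zero_sub, neg_div] at h
  exact h

/-- For ρ ∈ [0,1) and Φ > 1 − ρ, the gap h(z) := v̲(z) − U(e^z) is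
nonnegative on ℝ and vanishes exactly on [b̲, ∞); it is strictly decreasing on
(−∞, b̲], with derivative h′(z) = e^{(1−ρ)z}( e^{(Φ−1+ρ)(z−b̲)} − 1 ) for z < b̲, and
h(z) → 1/(1−ρ) as z → −∞. -/
theorem gap_of_vLow_properties
    (ρ Φ : ℝ) (hρ : ρ ∈ Set.Ico (0 : ℝ) 1) (hΦ : 1 - ρ < Φ) :
    (∀ z : ℝ, 0 ≤ vLow ρ Φ z - Ue ρ z) ∧
    (∀ z : ℝ, vLow ρ Φ z - Ue ρ z = 0 ↔ bLow ρ Φ ≤ z) ∧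
    StrictAntiOn (fun z => vLow ρ Φ z - Ue ρ z) (Set.Iic (bLow ρ Φ)) ∧
    (∀ z < bLow ρ Φ,
      HasDerivAt (fun z => vLow ρ Φ z - Ue ρ z)
        (Real.exp ((1 - ρ) * z) * (Real.exp ((Φ - 1 + ρ) * (z - bLow ρ Φ)) - 1)) z) ∧
    Filter.Tendsto (fun z => vLow ρ Φ z - Ue ρ z) Filter.atBot (nhds (1 / (1 - ρ))) := by
  have h2 : 0 < Φ - 1 + ρ := by linarith
  have h3 : 0 < Φ := (sub_pos.2 hρ.2).trans hΦ
  have hle : ∀ z ≤ bLow ρ Φ, vLow ρ Φ z - Ue ρ z =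
      Real.exp (Φ * (z - bLow ρ Φ)) * Ue ρ (bLow ρ Φ) - Ue ρ z := fun z hz => by
    rw [vLow, if_pos hz]
  have hzero : ∀ z, bLow ρ Φ ≤ z → vLow ρ Φ z - Ue ρ z = 0 := fun z hz => by
    rcases hz.eq_or_lt with rfl | hz
    · simp [vLow]
    · rw [vLow, if_neg hz.not_ge, sub_self]
  have hanti : StrictAntiOn (fun z => vLow ρ Φ z - Ue ρ z) (Set.Iic (bLow ρ Φ)) := by
    refine StrictAntiOn.congr (strictAntiOn_of_deriv_neg (convex_Iic _)
      (fun z _ => (hasDerivAt_gap_of_le hρ hΦ z).continuousAt.continuousWithinAt)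
      fun z hz => ?_) fun z hz => (hle z hz).symm
    rw [interior_Iic] at hz
    rw [(hasDerivAt_gap_of_le hρ hΦ z).deriv]
    exact mul_neg_of_pos_of_neg (Real.exp_pos _) (sub_neg.2
      (Real.exp_lt_one_iff.2 (mul_neg_of_pos_of_neg h2 (sub_neg.2 hz))))
  have hpos : ∀ z < bLow ρ Φ, 0 < vLow ρ Φ z - Ue ρ z := fun z hz => by
    have h := hanti hz.le (le_refl (bLow ρ Φ)) hz
    simpa only [hzero _ le_rfl] using h
  refine ⟨fun z => ?_, fun z => ⟨fun h => ?_, hzero z⟩, hanti, fun z hz => ?_, ?_⟩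
  · rcases lt_or_ge z (bLow ρ Φ) with hz | hz
    · exact (hpos z hz).le
    · exact (hzero z hz).ge
  · by_contra! hz
    exact (hpos z hz).ne' h
  · refine (hasDerivAt_gap_of_le hρ hΦ z).congr_of_eventuallyEq ?_
    filter_upwards [Iio_mem_nhds hz] with y hy using hle y (le_of_lt hy)
  · have hlin : Filter.Tendsto (fun z => Φ * (z - bLow ρ Φ)) Filter.atBot Filter.atBot :=
      (Filter.tendsto_atBot_add_const_right _ (-bLow ρ Φ) Filter.tendsto_id).const_mul_atBot h3
    have h := ((Real.tendsto_exp_atBot.comp hlin).mul_const (Ue ρ (bLow ρ Φ))).sub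
      (tendsto_Ue_atBot hρ.2)
    rw [zero_mul, zero_sub, neg_neg] at h
    refine h.congr' ?_
    filter_upwards [Filter.eventually_le_atBot (bLow ρ Φ)] with z hz using (hle z hz).symm
end

section
/- Suppose ρ ∈ [0,1), Φ > 1 − ρ and ψ(1−ρ) < r. Then the function χ(x) := r/(1−ρ) − ((r − ψ(1−ρ))/(1−ρ)) e^{(1−ρ)x} + f(x) is continuous and strictly decreasing on [b̲, ∞), and χ(x) → −∞ as x → ∞. -/
open MeasureTheory

/-- The jump-gap integral `f(x) = ∫_{(−∞,0)} (v̲(x+w) − U(e^{x+w})) ν(dw)`, where `ν` is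
the Lévy measure (denoted Π in the paper). -/
noncomputable def fGap (ρ Φ : ℝ) (ν : Measure ℝ) (x : ℝ) : ℝ :=
  ∫ w in Set.Iio (0 : ℝ), (vLow ρ Φ (x + w) - Ue ρ (x + w)) ∂ν

/-- The Laplace exponent of a spectrally negative Lévy process with triplet (μ, σ², ν):
`ψ(β) = μβ + ½σ²β² + ∫_{(−∞,0)} (e^{βw} − 1 − βw·1_{(−1,0)}(w)) ν(dw)`. -/
noncomputable def laplaceExponent (μ σ : ℝ) (ν : Measure ℝ) (β : ℝ) : ℝ :=
  μ * β + σ ^ 2 * β ^ 2 / 2 +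
    ∫ w in Set.Iio (0 : ℝ),
      (Real.exp (β * w) - 1 - (if w ∈ Set.Ioo (-1 : ℝ) 0 then β * w else 0)) ∂ν

/-- `χ(x) = r/(1−ρ) − ((r − ψ(1−ρ))/(1−ρ)) e^{(1−ρ)x} + f(x)`. -/
noncomputable def chiFn (ρ Φ μ σ r : ℝ) (ν : Measure ℝ) (x : ℝ) : ℝ :=
  r / (1 - ρ) - ((r - laplaceExponent μ σ ν (1 - ρ)) / (1 - ρ)) * Real.exp ((1 - ρ) * x) +
    fGap ρ Φ ν x

/-- The gap `v̲ - U ∘ exp` as a function of the distance to `b̲`, on the half-line `t ≤ 0`. -/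
noncomputable def gapProfile (a Φ t : ℝ) : ℝ :=
  Real.exp (Φ * t) / (Φ - a) - Φ * Real.exp (a * t) / (a * (Φ - a)) + 1 / a

lemma gapProfile_zero {a Φ : ℝ} (ha : 0 < a) (hΦ : a < Φ) : gapProfile a Φ 0 = 0 := by
  have h : Φ - a ≠ 0 := by linarith
  simp only [gapProfile, mul_zero, Real.exp_zero]
  field_simp
  ring

lemma continuous_gapProfile (a Φ : ℝ) : Continuous (gapProfile a Φ) := by
  unfold gapProfile
  fun_prop

lemma hasDerivAt_gapProfile {a Φ : ℝ} (ha : 0 < a) (hΦ : a < Φ) (t : ℝ) :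
    HasDerivAt (gapProfile a Φ)
      (Φ / (Φ - a) * (Real.exp (Φ * t) - Real.exp (a * t))) t := by
  have h (c : ℝ) : HasDerivAt (fun t => Real.exp (c * t)) (Real.exp (c * t) * c) t := by
    simpa using ((hasDerivAt_id t).const_mul c).exp
  have hne : Φ - a ≠ 0 := by linarith
  refine ((((h Φ).div_const (Φ - a)).sub
    (((h a).const_mul Φ).div_const (a * (Φ - a)))).add_const (1 / a)).congr_deriv ?_
  field_simp

lemma antitoneOn_gapProfile {a Φ : ℝ} (ha : 0 < a) (hΦ : a < Φ) :
    AntitoneOn (gapProfile a Φ) (Set.Iic 0) := by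
  refine antitoneOn_of_deriv_nonpos (convex_Iic 0) (continuous_gapProfile a Φ).continuousOn
    (fun t _ => (hasDerivAt_gapProfile ha hΦ t).differentiableAt.differentiableWithinAt) ?_
  intro t ht
  rw [interior_Iic, Set.mem_Iio] at ht
  rw [(hasDerivAt_gapProfile ha hΦ t).deriv]
  refine mul_nonpos_of_nonneg_of_nonpos (div_nonneg (by linarith) (by linarith)) ?_
  exact sub_nonpos.2 (Real.exp_le_exp.2 (by nlinarith))

lemma gapProfile_nonneg {a Φ t : ℝ} (ha : 0 < a) (hΦ : a < Φ) (ht : t ≤ 0) :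
    0 ≤ gapProfile a Φ t := by
  simpa [gapProfile_zero ha hΦ] using
    antitoneOn_gapProfile ha hΦ (Set.mem_Iic.2 ht) Set.self_mem_Iic ht

lemma gapProfile_le_inv {a Φ t : ℝ} (ha : 0 < a) (hΦ : a < Φ) (ht : t ≤ 0) :
    gapProfile a Φ t ≤ 1 / a := by
  have hd : 0 < Φ - a := by linarith
  have h1 : Real.exp (Φ * t) ≤ Real.exp (a * t) := Real.exp_le_exp.2 (by nlinarith)
  have h2 := Real.exp_pos (a * t)
  have h : Real.exp (Φ * t) / (Φ - a) ≤ Φ * Real.exp (a * t) / (a * (Φ - a)) := by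
    rw [div_le_div_iff₀ hd (by positivity)]
    nlinarith [mul_le_mul_of_nonneg_left h1 (mul_pos ha hd).le,
      mul_pos (mul_pos hd hd) h2]
  unfold gapProfile
  linarith

lemma exp_le_one_add_add_sq_of_nonpos {s : ℝ} (hs : s ≤ 0) : Real.exp s ≤ 1 + s + s ^ 2 := by
  rcases le_total (-1) s with h | h
  · have := abs_le.1 (Real.abs_exp_sub_one_sub_id_le (abs_le.2 ⟨h, by linarith⟩))
    linarith [this.2]
  · have := Real.exp_le_one_iff.2 hs
    nlinarith

lemma gapProfile_le_sq {a Φ t : ℝ} (ha : 0 < a) (hΦ : a < Φ) (ht : t ≤ 0) :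
    gapProfile a Φ t ≤ Φ ^ 2 / (Φ - a) * t ^ 2 := by
  have hd : 0 < Φ - a := by linarith
  have h1 := exp_le_one_add_add_sq_of_nonpos (s := Φ * t)
    (mul_nonpos_of_nonneg_of_nonpos (by linarith) ht)
  have h2 := Real.add_one_le_exp (a * t)
  have h3 : gapProfile a Φ t ≤ (1 + Φ * t + (Φ * t) ^ 2) / (Φ - a)
      - Φ * (a * t + 1) / (a * (Φ - a)) + 1 / a := by
    unfold gapProfile
    have : 0 ≤ Φ := by linarith
    gcongr
  refine h3.trans_eq ?_
  field_simp
  ring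

lemma vLow_sub_Ue {ρ Φ : ℝ} (hρ : ρ < 1) (hΦ : 1 - ρ < Φ) (y : ℝ) :
    vLow ρ Φ y - Ue ρ y = gapProfile (1 - ρ) Φ (min (y - bLow ρ Φ) 0) := by
  have ha : 0 < 1 - ρ := by linarith
  have hd : 0 < Φ - (1 - ρ) := by linarith
  have hb : Real.exp ((1 - ρ) * bLow ρ Φ) = Φ / (Φ - (1 - ρ)) := by
    have : (1 - ρ) * bLow ρ Φ = Real.log (Φ / (Φ - (1 - ρ))) := by
      rw [bLow, show Φ - 1 + ρ = Φ - (1 - ρ) by ring]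
      field_simp
    rw [this, Real.exp_log (div_pos (by linarith) hd)]
  by_cases h : y ≤ bLow ρ Φ
  · have hy : Real.exp ((1 - ρ) * y)
        = Real.exp ((1 - ρ) * (y - bLow ρ Φ)) * (Φ / (Φ - (1 - ρ))) := by
      rw [← hb, ← Real.exp_add]
      ring_nf
    rw [min_eq_left (by linarith), vLow, if_pos h, gapProfile, Ue, Ue, hb, hy]
    generalize 1 - ρ = a at *
    field_simp
    ring
  · rw [min_eq_right (by linarith), vLow, if_neg h, sub_self, gapProfile_zero ha hΦ]

lemma continuous_gapProfile_min (a Φ b : ℝ) :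
    Continuous fun y => gapProfile a Φ (min (y - b) 0) :=
  (continuous_gapProfile a Φ).comp (by fun_prop)

lemma gapProfile_min_le {a Φ s w : ℝ} (ha : 0 < a) (hΦ : a < Φ) (hs : 0 ≤ s) :
    gapProfile a Φ (min (s + w) 0) ≤ (1 / a + Φ ^ 2 / (Φ - a)) * min 1 (w ^ 2) := by
  have hd : 0 < Φ - a := by linarith
  have h0 : min (s + w) 0 ≤ 0 := min_le_right _ _
  have hsq : (min (s + w) 0) ^ 2 ≤ w ^ 2 := by
    rcases le_total (s + w) 0 with h | h
    · rw [min_eq_left h]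
      nlinarith
    · rw [min_eq_right h]
      nlinarith
  have hK : 0 ≤ Φ ^ 2 / (Φ - a) := by positivity
  have ha' : 0 ≤ 1 / a := by positivity
  rcases min_choice 1 (w ^ 2) with h | h <;> rw [h]
  · linarith [gapProfile_le_inv ha hΦ h0]
  · nlinarith [gapProfile_le_sq ha hΦ h0, mul_le_mul_of_nonneg_left hsq hK,
      mul_nonneg ha' (sq_nonneg w)]

lemma norm_vLow_sub_Ue_le {ρ Φ x : ℝ} (hρ : ρ < 1) (hΦ : 1 - ρ < Φ) (hx : bLow ρ Φ ≤ x)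
    (w : ℝ) :
    ‖vLow ρ Φ (x + w) - Ue ρ (x + w)‖
      ≤ (1 / (1 - ρ) + Φ ^ 2 / (Φ - (1 - ρ))) * min 1 (w ^ 2) := by
  have ha : 0 < 1 - ρ := by linarith
  rw [vLow_sub_Ue hρ hΦ, Real.norm_of_nonneg (gapProfile_nonneg ha hΦ (min_le_right _ _)),
    show x + w - bLow ρ Φ = x - bLow ρ Φ + w by ring]
  exact gapProfile_min_le ha hΦ (by linarith)

lemma continuous_vLow_sub_Ue {ρ Φ : ℝ} (hρ : ρ < 1) (hΦ : 1 - ρ < Φ) :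
    Continuous fun y => vLow ρ Φ y - Ue ρ y := by
  simp_rw [vLow_sub_Ue hρ hΦ]
  exact continuous_gapProfile_min _ _ _

lemma antitone_vLow_sub_Ue {ρ Φ : ℝ} (hρ : ρ < 1) (hΦ : 1 - ρ < Φ) :
    Antitone fun y => vLow ρ Φ y - Ue ρ y := by
  intro x y hxy
  simp only [vLow_sub_Ue hρ hΦ]
  exact antitoneOn_gapProfile (by linarith) hΦ (Set.mem_Iic.2 (min_le_right _ _))
    (Set.mem_Iic.2 (min_le_right _ _)) (min_le_min_right _ (by linarith))

lemma aestronglyMeasurable_vLow_sub_Ue {ρ Φ : ℝ} (hρ : ρ < 1) (hΦ : 1 - ρ < Φ) (x : ℝ)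
    (m : Measure ℝ) :
    AEStronglyMeasurable (fun w => vLow ρ Φ (x + w) - Ue ρ (x + w)) m :=
  ((continuous_vLow_sub_Ue hρ hΦ).comp (continuous_const_add x)).aestronglyMeasurable

lemma continuousOn_fGap {ρ Φ : ℝ} (hρ : ρ < 1) (hΦ : 1 - ρ < Φ) {ν : Measure ℝ}
    (hν : IntegrableOn (fun w => min 1 (w ^ 2)) (Set.Iio (0 : ℝ)) ν) :
    ContinuousOn (fGap ρ Φ ν) (Set.Ici (bLow ρ Φ)) := by
  refine continuousOn_of_dominated (fun x _ => aestronglyMeasurable_vLow_sub_Ue hρ hΦ x _)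
    (fun x hx => ae_of_all _ (norm_vLow_sub_Ue_le hρ hΦ hx)) (hν.const_mul _)
    (ae_of_all _ fun w => ?_)
  exact ((continuous_vLow_sub_Ue hρ hΦ).comp (continuous_add_const w)).continuousOn

lemma antitoneOn_fGap {ρ Φ : ℝ} (hρ : ρ < 1) (hΦ : 1 - ρ < Φ) {ν : Measure ℝ}
    (hν : IntegrableOn (fun w => min 1 (w ^ 2)) (Set.Iio (0 : ℝ)) ν) :
    AntitoneOn (fGap ρ Φ ν) (Set.Ici (bLow ρ Φ)) := by
  have hint {x : ℝ} (hx : bLow ρ Φ ≤ x) :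
      Integrable (fun w => vLow ρ Φ (x + w) - Ue ρ (x + w)) (ν.restrict (Set.Iio 0)) :=
    (hν.const_mul _).mono' (aestronglyMeasurable_vLow_sub_Ue hρ hΦ x _)
      (ae_of_all _ (norm_vLow_sub_Ue_le hρ hΦ hx))
  intro x hx y hy hxy
  exact integral_mono (hint hy) (hint hx)
    fun w => antitone_vLow_sub_Ue hρ hΦ (by linarith : x + w ≤ y + w)

/-- Suppose ρ ∈ [0,1), Φ > 1 − ρ and ψ(1−ρ) < r. Then χ is continuous and
strictly decreasing on [b̲, ∞), and χ(x) → −∞ as x → ∞. -/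
theorem chi_continuous_strictAnti_tendsto_atBot
    (ρ Φ μ σ r : ℝ) (hρ : ρ ∈ Set.Ico (0 : ℝ) 1) (hΦ : 1 - ρ < Φ)
    (hσ : 0 ≤ σ) (hr : 0 < r)
    (ν : Measure ℝ)
    (hν : IntegrableOn (fun w => min 1 (w ^ 2)) (Set.Iio (0 : ℝ)) ν)
    (hψ : laplaceExponent μ σ ν (1 - ρ) < r) :
    ContinuousOn (chiFn ρ Φ μ σ r ν) (Set.Ici (bLow ρ Φ)) ∧
    StrictAntiOn (chiFn ρ Φ μ σ r ν) (Set.Ici (bLow ρ Φ)) ∧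
    Filter.Tendsto (chiFn ρ Φ μ σ r ν) Filter.atTop Filter.atBot := by
  have ha : 0 < 1 - ρ := by linarith [hρ.2]
  have hc : 0 < (r - laplaceExponent μ σ ν (1 - ρ)) / (1 - ρ) := div_pos (by linarith) ha
  have hf := antitoneOn_fGap hρ.2 hΦ hν
  refine ⟨?_, ?_, ?_⟩
  · unfold chiFn
    exact ContinuousOn.add (by fun_prop) (continuousOn_fGap hρ.2 hΦ hν)
  · intro x hx y hy hxy
    have h1 := hf hx hy hxy.le
    have h2 : Real.exp ((1 - ρ) * x) < Real.exp ((1 - ρ) * y) :=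
      Real.exp_lt_exp.2 (mul_lt_mul_of_pos_left hxy ha)
    have h3 := mul_lt_mul_of_pos_left h2 hc
    unfold chiFn
    linarith
  · have hexp : Filter.Tendsto (fun x => (r - laplaceExponent μ σ ν (1 - ρ)) / (1 - ρ) *
        Real.exp ((1 - ρ) * x)) Filter.atTop Filter.atTop :=
      (Real.tendsto_exp_atTop.comp (Filter.tendsto_id.const_mul_atTop ha)).const_mul_atTop hc
    refine Filter.tendsto_atBot_mono' _ ?_ (Filter.tendsto_atBot_add_const_left _
      (r / (1 - ρ) + fGap ρ Φ ν (bLow ρ Φ)) (Filter.tendsto_neg_atTop_atBot.comp hexp))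
    filter_upwards [Filter.eventually_ge_atTop (bLow ρ Φ)] with x hx
    have := hf Set.self_mem_Ici hx hx
    simp only [chiFn, Function.comp_apply]
    linarith
end
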